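/- Let D be a finite set, d ≥ 1, g_i ∈ ℝ^d for i ∈ D, α > 0, and for S ⊆ D let F_S = ∑_{y∈S} g_y g_yᵀ, Δ_x(S) = log det(I + αF_{S∪{x}}) − log det(I + αF_S), base_x = log(1 + α‖g_x‖²), and ε_x(S) = Δ_x(S) − base_x. Suppose there exist G_max > 0 and ρ ∈ (0,1) with ‖g_x‖ ≤ G_max for all x ∈ D, with the operator norm bound α‖F_S‖ ≤ ρ, and with 1 − ρ − α G_max² ρ > 0. Then for every x ∈ D with x ∉ S, |ε_x(S)| ≤ C · α² ∑_{y∈S} (g_xᵀ g_y)² / (1 + α‖g_x‖²), where C = 1/(1 − ρ − α G_max² ρ). -/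

import Mathlib

open Matrix Finset

/-- Fisher matrix `F_S = ∑_{y∈S} g_y g_yᵀ`. -/
noncomputable def fisherMatrix {ι : Type*} [DecidableEq ι] {d : ℕ}
    (g : ι → (Fin d → ℝ)) (S : Finset ι) : Matrix (Fin d) (Fin d) ℝ :=
  ∑ y ∈ S, vecMulVec (g y) (g y)

/-- Fisher utility `F(S) = log det (I + α F_S)`. -/
noncomputable def fisherUtility {ι : Type*} [DecidableEq ι] {d : ℕ}
    (g : ι → (Fin d → ℝ)) (α : ℝ) (S : Finset ι) : ℝ :=
  Real.log ((1 + α • fisherMatrix g S).det)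

/-- Marginal gain `Δ_x(S) = F(S ∪ {x}) − F(S)`. -/
noncomputable def fisherDelta {ι : Type*} [DecidableEq ι] {d : ℕ}
    (g : ι → (Fin d → ℝ)) (α : ℝ) (x : ι) (S : Finset ι) : ℝ :=
  fisherUtility g α (insert x S) - fisherUtility g α S

/-- Modular baseline `base_x = log (1 + α ‖gₓ‖²)`. -/
noncomputable def fisherBase {ι : Type*} {d : ℕ}
    (g : ι → (Fin d → ℝ)) (α : ℝ) (x : ι) : ℝ :=
  Real.log (1 + α * (g x ⬝ᵥ g x))

/-- Perturbation `ε_x(S) = Δ_x(S) − base_x`. -/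
noncomputable def fisherEps {ι : Type*} [DecidableEq ι] {d : ℕ}
    (g : ι → (Fin d → ℝ)) (α : ℝ) (x : ι) (S : Finset ι) : ℝ :=
  fisherDelta g α x S - fisherBase g α x

/-- Operator (spectral) norm of a matrix, as the norm of the induced map on
Euclidean space. -/
noncomputable def matOpNorm {d : ℕ} (A : Matrix (Fin d) (Fin d) ℝ) : ℝ :=
  ‖Matrix.toEuclideanCLM (𝕜 := ℝ) A‖

theorem det_add_vecMulVec_mulVec {n : Type*} [Fintype n] [DecidableEq n]
    (A : Matrix n n ℝ) (v w : n → ℝ) :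
    (A + vecMulVec (A *ᵥ v) w).det = A.det * (1 + w ⬝ᵥ v) := by
  rw [← Matrix.mul_vecMulVec, ← mul_one_add, Matrix.det_mul, vecMulVec_eq Unit,
    Matrix.det_one_add_replicateCol_mul_replicateRow]

theorem posSemidef_fisherMatrix {ι : Type*} [DecidableEq ι] {d : ℕ}
    (g : ι → (Fin d → ℝ)) (S : Finset ι) : (fisherMatrix g S).PosSemidef :=
  Matrix.posSemidef_sum S fun y _ => by simpa using Matrix.posSemidef_vecMulVec_self_star (g y)

theorem dotProduct_fisherMatrix_mulVec {ι : Type*} [DecidableEq ι] {d : ℕ}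
    (g : ι → (Fin d → ℝ)) (S : Finset ι) (u : Fin d → ℝ) :
    u ⬝ᵥ fisherMatrix g S *ᵥ u = ∑ y ∈ S, (u ⬝ᵥ g y) ^ 2 := by
  rw [fisherMatrix, Matrix.sum_mulVec, dotProduct_sum]
  refine Finset.sum_congr rfl fun y _ => ?_
  rw [Matrix.vecMulVec_mulVec, op_smul_eq_smul, dotProduct_smul, smul_eq_mul,
    dotProduct_comm (g y), sq]

theorem fisherMatrix_insert {ι : Type*} [DecidableEq ι] {d : ℕ}
    (g : ι → (Fin d → ℝ)) {x : ι} {S : Finset ι} (hx : x ∉ S) :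
    fisherMatrix g (insert x S) = fisherMatrix g S + vecMulVec (g x) (g x) := by
  rw [fisherMatrix, Finset.sum_insert hx, add_comm, fisherMatrix]

theorem dotProduct_mulVec_le_matOpNorm {d : ℕ} (A : Matrix (Fin d) (Fin d) ℝ) (u : Fin d → ℝ) :
    u ⬝ᵥ A *ᵥ u ≤ matOpNorm A * (u ⬝ᵥ u) := by
  set x : EuclideanSpace ℝ (Fin d) := WithLp.toLp 2 u
  have hxx : ‖x‖ * ‖x‖ = u ⬝ᵥ u := by
    rw [← real_inner_self_eq_norm_mul_norm, EuclideanSpace.inner_toLp_toLp, star_trivial]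
  have hxA : inner ℝ x (Matrix.toEuclideanCLM (𝕜 := ℝ) A x) = u ⬝ᵥ A *ᵥ u :=
    Matrix.inner_toEuclideanCLM A x x
  calc u ⬝ᵥ A *ᵥ u ≤ ‖x‖ * ‖Matrix.toEuclideanCLM (𝕜 := ℝ) A x‖ :=
        hxA ▸ real_inner_le_norm _ _
    _ ≤ ‖x‖ * (matOpNorm A * ‖x‖) := by
        gcongr
        exact ContinuousLinearMap.le_opNorm _ _
    _ = matOpNorm A * (u ⬝ᵥ u) := by rw [← hxx]; ring

theorem Matrix.PosSemidef.sub_dotProduct_mem_Icc {n : Type*} [Fintype n] [DecidableEq n]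
    {M : Matrix n n ℝ} (hM : M.PosSemidef) {u v : n → ℝ} (huv : (1 + M) *ᵥ v = u) :
    u ⬝ᵥ u - u ⬝ᵥ v ∈ Set.Icc 0 (u ⬝ᵥ M *ᵥ u) := by
  have hadj (a b : n → ℝ) : (M *ᵥ a) ⬝ᵥ b = a ⬝ᵥ M *ᵥ b := by
    have hT : Mᵀ = M := by simpa using hM.isHermitian.eq
    rw [dotProduct_mulVec, ← Matrix.mulVec_transpose, hT]
  have h0 : 0 ≤ v ⬝ᵥ M *ᵥ v := by simpa using hM.dotProduct_mulVec_nonneg v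
  have h1 : 0 ≤ (M *ᵥ v) ⬝ᵥ M *ᵥ (M *ᵥ v) := by
    simpa using hM.dotProduct_mulVec_nonneg (M *ᵥ v)
  have h2 : 0 ≤ (M *ᵥ v) ⬝ᵥ (M *ᵥ v) := by simpa using dotProduct_star_self_nonneg (M *ᵥ v)
  rw [add_mulVec, one_mulVec] at huv
  subst huv
  simp only [mulVec_add, dotProduct_add, add_dotProduct, hadj, Set.mem_Icc] at *
  constructor <;> linarith

theorem Real.abs_log_sub_log_le {a b : ℝ} (ha : 0 < a) (hab : a ≤ b) :
    |Real.log a - Real.log b| ≤ (b - a) / a := by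
  have hb : 0 < b := ha.trans_le hab
  rw [abs_sub_comm, abs_of_nonneg (sub_nonneg.2 (Real.log_le_log ha hab)),
    ← Real.log_div hb.ne' ha.ne', sub_div, div_self ha.ne']
  exact Real.log_le_sub_one_of_pos (div_pos hb ha)

/-- Perturbation bound via gradient alignment: under
`‖gₓ‖ ≤ G_max`, `α ‖F_S‖ ≤ ρ < 1` and `1 − ρ − α G_max² ρ > 0`, for all `x ∉ S`,
`|ε_x(S)| ≤ C · α² ∑_{y∈S} (gₓᵀ g_y)² / (1 + α ‖gₓ‖²)` with
`C = 1/(1 − ρ − α G_max² ρ)`. -/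
theorem fisherEps_bound_gradient_alignment
    {ι : Type*} [Fintype ι] [DecidableEq ι] {d : ℕ} (hd : 1 ≤ d)
    (g : ι → (Fin d → ℝ)) (α : ℝ) (hα : 0 < α)
    (Gmax ρ : ℝ) (hG : 0 < Gmax) (hρ0 : 0 < ρ) (hρ1 : ρ < 1)
    (hGbound : ∀ x : ι, Real.sqrt (g x ⬝ᵥ g x) ≤ Gmax)
    (S : Finset ι)
    (hFS : α * matOpNorm (fisherMatrix g S) ≤ ρ)
    (hden : 0 < 1 - ρ - α * Gmax ^ 2 * ρ) :
    ∀ x : ι, x ∉ S →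
      |fisherEps g α x S| ≤
        (1 / (1 - ρ - α * Gmax ^ 2 * ρ)) *
          (α ^ 2 * ∑ y ∈ S, (g x ⬝ᵥ g y) ^ 2) / (1 + α * (g x ⬝ᵥ g x)) := by
  intro x hx
  set M := α • fisherMatrix g S with hMdef
  have hM : M.PosSemidef := (posSemidef_fisherMatrix g S).smul hα.le
  have hdet : 0 < (1 + M).det := (Matrix.PosDef.one.add_posSemidef hM).det_pos
  set u := g x
  set v := (1 + M)⁻¹ *ᵥ u
  have huv : (1 + M) *ᵥ v = u := by
    rw [mulVec_mulVec, Matrix.mul_nonsing_inv _ hdet.ne'.isUnit, one_mulVec]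
  obtain ⟨hgap, hgap'⟩ := hM.sub_dotProduct_mem_Icc huv
  have hquad : u ⬝ᵥ M *ᵥ u = α * ∑ y ∈ S, (u ⬝ᵥ g y) ^ 2 := by
    rw [smul_mulVec, dotProduct_smul, dotProduct_fisherMatrix_mulVec, smul_eq_mul]
  have hs : 0 ≤ u ⬝ᵥ u := by simpa using dotProduct_star_self_nonneg u
  have hquad_le : u ⬝ᵥ M *ᵥ u ≤ ρ * (u ⬝ᵥ u) := by
    rw [smul_mulVec, dotProduct_smul, smul_eq_mul]
    calc α * (u ⬝ᵥ fisherMatrix g S *ᵥ u)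
        ≤ α * (matOpNorm (fisherMatrix g S) * (u ⬝ᵥ u)) := by
          gcongr
          exact dotProduct_mulVec_le_matOpNorm _ _
      _ = α * matOpNorm (fisherMatrix g S) * (u ⬝ᵥ u) := by ring
      _ ≤ ρ * (u ⬝ᵥ u) := by gcongr
  have hsG : u ⬝ᵥ u ≤ Gmax ^ 2 := (Real.sqrt_le_left hG.le).1 (hGbound x)
  have hq : 0 ≤ u ⬝ᵥ v := by nlinarith
  have hpos : 0 < 1 + α * (u ⬝ᵥ v) := by positivity
  have heps : fisherEps g α x S =
      Real.log (1 + α * (u ⬝ᵥ v)) - Real.log (1 + α * (u ⬝ᵥ u)) := by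
    have hins : 1 + α • fisherMatrix g (insert x S) =
        (1 + M) + vecMulVec ((1 + M) *ᵥ v) (α • u) := by
      rw [huv, fisherMatrix_insert g hx, smul_add, vecMulVec_smul, add_assoc]
    rw [fisherEps, fisherDelta, fisherBase, fisherUtility, fisherUtility, hins,
      det_add_vecMulVec_mulVec, smul_dotProduct, smul_eq_mul, ← hMdef,
      Real.log_mul hdet.ne' hpos.ne', add_sub_cancel_left]
  have hratio : (1 - ρ - α * Gmax ^ 2 * ρ) * (1 + α * (u ⬝ᵥ u)) ≤ 1 + α * (u ⬝ᵥ v) := by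
    have h1 : α * ρ * (u ⬝ᵥ u) ≤ α * ρ * Gmax ^ 2 := by gcongr
    have h2 : α * ((1 - ρ) * (u ⬝ᵥ u)) ≤ α * (u ⬝ᵥ v) := by gcongr; linarith
    have h3 : 0 ≤ α * (u ⬝ᵥ u) := by positivity
    have h4 : 0 ≤ α * Gmax ^ 2 * ρ * (α * (u ⬝ᵥ u)) := by positivity
    have h5 : 0 ≤ α * Gmax ^ 2 * ρ := by positivity
    linarith
  have hbase : 0 < 1 + α * (u ⬝ᵥ u) := by positivity
  have hsum : 0 ≤ ∑ y ∈ S, (u ⬝ᵥ g y) ^ 2 := Finset.sum_nonneg fun _ _ => sq_nonneg _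
  calc |fisherEps g α x S|
      ≤ (1 + α * (u ⬝ᵥ u) - (1 + α * (u ⬝ᵥ v))) / (1 + α * (u ⬝ᵥ v)) := by
        rw [heps]
        refine Real.abs_log_sub_log_le hpos ?_
        gcongr
        linarith
    _ ≤ (α ^ 2 * ∑ y ∈ S, (u ⬝ᵥ g y) ^ 2) / (1 + α * (u ⬝ᵥ v)) := by
        gcongr
        nlinarith
    _ ≤ (α ^ 2 * ∑ y ∈ S, (u ⬝ᵥ g y) ^ 2) /
          ((1 - ρ - α * Gmax ^ 2 * ρ) * (1 + α * (u ⬝ᵥ u))) := by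
        gcongr
    _ = _ := by rw [one_div_mul_eq_div, div_div]
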